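/- Let R be a Cu-semiring. For r ∈ R and any path (r_λ)_λ in (R,≪) with endpoint r, the left-multiplication maps f_λ: R → R, f_λ(a) = r_λ·a, form a path in Cu[R,R], and the class π_R(r) := [(f_λ)_λ] ∈ ⟦R,R⟧ does not depend on the choice of path. The resulting map π_R: R → ⟦R,R⟧ is a Cu-morphism that is multiplicative: π_R(rs) = π_R(r)∘π_R(s) for all r, s ∈ R. Moreover, if the unit 1_R of R is a compact element, then π_R(1_R) = ⟨id_R⟩, the unit of the Cu-semiring ⟦R,R⟧. -/

import Mathlib

/-! ### Abstract Cuntz semigroups: basic framework -/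

/-- The way-below (compact containment) relation. -/
def WayBelow {S : Type*} [Preorder S] (a b : S) : Prop :=
  ∀ c : ℕ → S, Monotone c → ∀ s : S, IsLUB (Set.range c) s → b ≤ s → ∃ n, a ≤ c n

/-- A `Cu`-semigroup (abstract Cuntz semigroup): a positively ordered monoid
satisfying the axioms (O1)-(O4). -/
class CuSemigroup (S : Type*) [AddCommMonoid S] [PartialOrder S] : Prop where
  add_le_add' : ∀ a b c d : S, a ≤ b → c ≤ d → a + c ≤ b + d
  zero_le' : ∀ a : S, (0 : S) ≤ a
  O1 : ∀ c : ℕ → S, Monotone c → ∃ s : S, IsLUB (Set.range c) s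
  O2 : ∀ a : S, ∃ c : ℕ → S, (∀ n, WayBelow (c n) (c (n + 1))) ∧ IsLUB (Set.range c) a
  O3 : ∀ a' a b' b : S, WayBelow a' a → WayBelow b' b → WayBelow (a' + b') (a + b)
  O4 : ∀ (c d : ℕ → S) (s t : S), Monotone c → Monotone d →
      IsLUB (Set.range c) s → IsLUB (Set.range d) t →
      IsLUB (Set.range (fun n => c n + d n)) (s + t)

section WayBelowBasic

variable {S : Type*} [Preorder S]

theorem WayBelow.le {a b : S} (h : WayBelow a b) : a ≤ b := by
  obtain ⟨n, hn⟩ := h (fun _ => b) monotone_const b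
    (by rw [Set.range_const]; exact isLUB_singleton) le_rfl
  exact hn

theorem WayBelow.of_le_left {x a b : S} (hx : x ≤ a) (h : WayBelow a b) : WayBelow x b :=
  fun c hc s hs hbs => (h c hc s hs hbs).imp fun _ hn => hx.trans hn

theorem WayBelow.of_le_right {a b y : S} (h : WayBelow a b) (hy : b ≤ y) : WayBelow a y :=
  fun c hc s hs hys => h c hc s hs (hy.trans hys)

end WayBelowBasic

theorem wayBelow_zero {S : Type*} [AddCommMonoid S] [PartialOrder S] [CuSemigroup S] {a : S} :
    WayBelow (0 : S) a :=
  fun _ _ _ _ _ => ⟨0, CuSemigroup.zero_le' _⟩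

/-- Interpolation: if `a' ≪ a` then there is `x` with `a' ≪ x ≪ a`. -/
theorem exists_interpolate {S : Type*} [AddCommMonoid S] [PartialOrder S] [CuSemigroup S]
    {a' a : S} (h : WayBelow a' a) : ∃ x : S, WayBelow a' x ∧ WayBelow x a := by
  obtain ⟨c, hc, hlub⟩ := CuSemigroup.O2 a
  have hmono : Monotone c := monotone_nat_of_le_succ fun n => (hc n).le
  obtain ⟨n, hn⟩ := h c hmono a hlub le_rfl
  exact ⟨c (n + 1), WayBelow.of_le_left hn (hc n),
    WayBelow.of_le_right (hc (n + 1)) (hlub.1 (Set.mem_range_self (n + 2)))⟩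

/-! ### Generalized Cu-morphisms -/

/-- A generalized `Cu`-morphism: additive, monotone, zero preserving map which preserves
suprema of increasing sequences. -/
structure GenCuMor (S : Type*) (T : Type*) [AddCommMonoid S] [PartialOrder S]
    [AddCommMonoid T] [PartialOrder T] where
  toFun : S → T
  map_zero' : toFun 0 = 0
  map_add' : ∀ a b : S, toFun (a + b) = toFun a + toFun b
  mono' : Monotone toFun
  map_sup' : ∀ (c : ℕ → S) (s : S), Monotone c → IsLUB (Set.range c) s →
    IsLUB (Set.range (fun n => toFun (c n))) (toFun s)

namespace GenCuMor

variable {S T P : Type*} [AddCommMonoid S] [PartialOrder S] [AddCommMonoid T] [PartialOrder T]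
  [AddCommMonoid P] [PartialOrder P]

theorem ext' {f g : GenCuMor S T} (h : f.toFun = g.toFun) : f = g := by
  cases f; cases g; cases h; rfl

instance : PartialOrder (GenCuMor S T) where
  le f g := ∀ a : S, f.toFun a ≤ g.toFun a
  le_refl f a := le_rfl
  le_trans f g h h1 h2 a := (h1 a).trans (h2 a)
  le_antisymm f g h1 h2 := ext' (funext fun a => le_antisymm (h1 a) (h2 a))

theorem le_def {f g : GenCuMor S T} : f ≤ g ↔ ∀ a : S, f.toFun a ≤ g.toFun a := Iff.rfl

instance : Zero (GenCuMor S T) where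
  zero :=
    { toFun := fun _ => 0
      map_zero' := rfl
      map_add' := fun _ _ => (add_zero 0).symm
      mono' := monotone_const
      map_sup' := fun _ _ _ _ => by
        rw [Set.range_const]; exact isLUB_singleton }

@[simp] theorem zero_toFun (a : S) : (0 : GenCuMor S T).toFun a = 0 := rfl

instance [CuSemigroup T] : Add (GenCuMor S T) where
  add f g :=
    { toFun := fun a => f.toFun a + g.toFun a
      map_zero' := by show f.toFun 0 + g.toFun 0 = 0; rw [f.map_zero', g.map_zero', add_zero]
      map_add' := by
        intro a b
        show f.toFun (a + b) + g.toFun (a + b) = _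
        rw [f.map_add', g.map_add', add_add_add_comm]
      mono' := fun a b h => CuSemigroup.add_le_add' _ _ _ _ (f.mono' h) (g.mono' h)
      map_sup' := fun c s hc hs =>
        CuSemigroup.O4 (fun n => f.toFun (c n)) (fun n => g.toFun (c n)) _ _
          (fun _ _ h => f.mono' (hc h)) (fun _ _ h => g.mono' (hc h))
          (f.map_sup' c s hc hs) (g.map_sup' c s hc hs) }

@[simp] theorem add_toFun [CuSemigroup T] (f g : GenCuMor S T) (a : S) :
    (f + g).toFun a = f.toFun a + g.toFun a := rfl

instance [CuSemigroup T] : AddCommMonoid (GenCuMor S T) where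
  add := (· + ·)
  zero := 0
  add_assoc f g h := ext' (funext fun a => add_assoc (f.toFun a) (g.toFun a) (h.toFun a))
  zero_add f := ext' (funext fun a => zero_add (f.toFun a))
  add_zero f := ext' (funext fun a => add_zero (f.toFun a))
  add_comm f g := ext' (funext fun a => add_comm (f.toFun a) (g.toFun a))
  nsmul := nsmulRec
  nsmul_zero := fun _ => rfl
  nsmul_succ := fun _ _ => rfl

/-- Composition of generalized Cu-morphisms. -/
def comp (g : GenCuMor T P) (f : GenCuMor S T) : GenCuMor S P where
  toFun := fun a => g.toFun (f.toFun a)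
  map_zero' := by show g.toFun (f.toFun 0) = 0; rw [f.map_zero', g.map_zero']
  map_add' := fun a b => by
    show g.toFun (f.toFun (a + b)) = g.toFun (f.toFun a) + g.toFun (f.toFun b)
    rw [f.map_add', g.map_add']
  mono' := fun a b h => g.mono' (f.mono' h)
  map_sup' := fun c s hc hs =>
    g.map_sup' (fun n => f.toFun (c n)) (f.toFun s) (fun _ _ h => f.mono' (hc h))
      (f.map_sup' c s hc hs)

@[simp] theorem comp_toFun (g : GenCuMor T P) (f : GenCuMor S T) (a : S) :
    (g.comp f).toFun a = g.toFun (f.toFun a) := rfl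

/-- The identity generalized Cu-morphism. -/
def id (S : Type*) [AddCommMonoid S] [PartialOrder S] : GenCuMor S S where
  toFun := fun a => a
  map_zero' := rfl
  map_add' := fun _ _ => rfl
  mono' := monotone_id
  map_sup' := fun _ _ _ hs => hs

end GenCuMor

/-- The auxiliary relation `f ≺ g` on generalized Cu-morphisms. -/
def Prec {S T : Type*} [AddCommMonoid S] [PartialOrder S] [AddCommMonoid T] [PartialOrder T]
    (f g : GenCuMor S T) : Prop :=
  ∀ a' a : S, WayBelow a' a → WayBelow (f.toFun a') (g.toFun a)

namespace Prec

variable {S T P : Type*} [AddCommMonoid S] [PartialOrder S] [AddCommMonoid T] [PartialOrder T]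
  [AddCommMonoid P] [PartialOrder P]

theorem trans [CuSemigroup S] {f g h : GenCuMor S T} (h1 : Prec f g) (h2 : Prec g h) :
    Prec f h := by
  intro a' a ha
  obtain ⟨x, hx1, hx2⟩ := exists_interpolate ha
  exact WayBelow.of_le_left (h1 a' x hx1).le (h2 x a hx2)

theorem add [CuSemigroup T] {f g f' g' : GenCuMor S T} (h : Prec f g) (h' : Prec f' g') :
    Prec (f + f') (g + g') :=
  fun a' a ha => CuSemigroup.O3 _ _ _ _ (h a' a ha) (h' a' a ha)

theorem comp {f f' : GenCuMor S T} {g g' : GenCuMor T P} (hf : Prec f f') (hg : Prec g g') :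
    Prec (g.comp f) (g'.comp f') :=
  fun a' a ha => hg _ _ (hf a' a ha)

end Prec

/-! ### Paths and the bivariant Cu-semigroup -/

/-- The index set `ℚ ∩ (0,1)` for paths. -/
abbrev IQ : Type := {q : ℚ // 0 < q ∧ q < 1}

theorem IQ.exists_gt (l : IQ) : ∃ m : IQ, l.1 < m.1 := by
  refine ⟨⟨(l.1 + 1) / 2, ⟨by linarith [l.2.1, l.2.2], by linarith [l.2.2]⟩⟩, ?_⟩
  simp only
  linarith [l.2.2]

theorem IQ.exists_gt₂ (l m : IQ) : ∃ r : IQ, l.1 < r.1 ∧ m.1 < r.1 := by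
  have h1 : l.1 ≤ max l.1 m.1 := le_max_left _ _
  have h2 : m.1 ≤ max l.1 m.1 := le_max_right _ _
  have ht : max l.1 m.1 < 1 := max_lt l.2.2 m.2.2
  have ht0 : 0 < max l.1 m.1 := lt_of_lt_of_le l.2.1 h1
  refine ⟨⟨(max l.1 m.1 + 1) / 2, ⟨by linarith, by linarith⟩⟩, ?_, ?_⟩ <;>
    simp only <;> linarith

/-- A path of generalized Cu-morphisms: a `ℚ ∩ (0,1)`-indexed family which is increasing
with respect to the auxiliary relation `≺`. -/
structure CuPath (S T : Type*) [AddCommMonoid S] [PartialOrder S]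
    [AddCommMonoid T] [PartialOrder T] where
  f : IQ → GenCuMor S T
  prec : ∀ l m : IQ, l.1 < m.1 → Prec (f l) (f m)

namespace CuPath

variable {S T P : Type*} [AddCommMonoid S] [PartialOrder S] [AddCommMonoid T] [PartialOrder T]
  [AddCommMonoid P] [PartialOrder P]

theorem ext' {p q : CuPath S T} (h : p.f = q.f) : p = q := by
  cases p; cases q; cases h; rfl

end CuPath

/-- The preorder `f ≾ g` on paths. -/
def PathLE {S T : Type*} [AddCommMonoid S] [PartialOrder S] [AddCommMonoid T] [PartialOrder T]
    (p q : CuPath S T) : Prop :=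
  ∀ l : IQ, ∃ m : IQ, Prec (p.f l) (q.f m)

/-- The equivalence relation on paths: `p ∼ q` iff `p ≾ q` and `q ≾ p`. -/
def PathEquiv {S T : Type*} [AddCommMonoid S] [PartialOrder S] [AddCommMonoid T] [PartialOrder T]
    (p q : CuPath S T) : Prop :=
  PathLE p q ∧ PathLE q p

namespace PathLE

variable {S T : Type*} [AddCommMonoid S] [PartialOrder S] [AddCommMonoid T] [PartialOrder T]

theorem refl (p : CuPath S T) : PathLE p p := fun l =>
  let ⟨m, hm⟩ := IQ.exists_gt l
  ⟨m, p.prec l m hm⟩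

theorem trans [CuSemigroup S] {p q r : CuPath S T} (h1 : PathLE p q) (h2 : PathLE q r) :
    PathLE p r := fun l =>
  let ⟨m, hm⟩ := h1 l
  let ⟨n, hn⟩ := h2 m
  ⟨n, hm.trans hn⟩

end PathLE

instance CuPath.setoid (S T : Type*) [AddCommMonoid S] [PartialOrder S] [AddCommMonoid T]
    [PartialOrder T] [CuSemigroup S] : Setoid (CuPath S T) where
  r := PathEquiv
  iseqv :=
    { refl := fun p => ⟨PathLE.refl p, PathLE.refl p⟩
      symm := fun h => ⟨h.2, h.1⟩
      trans := fun h1 h2 => ⟨h1.1.trans h2.1, h2.2.trans h1.2⟩ }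

/-- The bivariant Cu-semigroup `⟦S,T⟧`: equivalence classes of paths. -/
def BivCu (S T : Type*) [AddCommMonoid S] [PartialOrder S] [AddCommMonoid T] [PartialOrder T]
    [CuSemigroup S] : Type _ :=
  Quotient (CuPath.setoid S T)

namespace BivCu

variable {S T P Q : Type*} [AddCommMonoid S] [PartialOrder S] [AddCommMonoid T] [PartialOrder T]
  [AddCommMonoid P] [PartialOrder P] [AddCommMonoid Q] [PartialOrder Q]

/-- Class of a path in the bivariant Cu-semigroup. -/
def mk [CuSemigroup S] (p : CuPath S T) : BivCu S T := Quotient.mk (CuPath.setoid S T) p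

instance [CuSemigroup S] : PartialOrder (BivCu S T) where
  le := Quotient.lift₂ PathLE (by
    intro p q p' q' hp hq
    exact propext ⟨fun h => (hp.2.trans h).trans hq.1, fun h => (hp.1.trans h).trans hq.2⟩)
  le_refl := by
    rintro ⟨p⟩
    exact PathLE.refl p
  le_trans := by
    rintro ⟨p⟩ ⟨q⟩ ⟨r⟩ h1 h2
    exact PathLE.trans h1 h2
  le_antisymm := by
    rintro ⟨p⟩ ⟨q⟩ h1 h2
    exact Quotient.sound ⟨h1, h2⟩

theorem mk_le_mk [CuSemigroup S] {p q : CuPath S T} : mk p ≤ mk q ↔ PathLE p q := Iff.rfl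

end BivCu

/-- Pointwise addition of paths. -/
def CuPath.add {S T : Type*} [AddCommMonoid S] [PartialOrder S] [AddCommMonoid T]
    [PartialOrder T] [CuSemigroup T] (p q : CuPath S T) : CuPath S T where
  f l := p.f l + q.f l
  prec l m h := (p.prec l m h).add (q.prec l m h)

/-- The zero path. -/
def CuPath.zero (S T : Type*) [AddCommMonoid S] [PartialOrder S] [AddCommMonoid T]
    [PartialOrder T] [CuSemigroup T] : CuPath S T where
  f _ := 0
  prec _ _ _ := fun _ _ _ => wayBelow_zero

theorem PathLE.add {S T : Type*} [AddCommMonoid S] [PartialOrder S] [AddCommMonoid T]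
    [PartialOrder T] [CuSemigroup S] [CuSemigroup T] {p p' q q' : CuPath S T}
    (hp : PathLE p p') (hq : PathLE q q') : PathLE (p.add q) (p'.add q') := by
  intro l
  obtain ⟨m1, h1⟩ := hp l
  obtain ⟨m2, h2⟩ := hq l
  obtain ⟨r, hr1, hr2⟩ := IQ.exists_gt₂ m1 m2
  exact ⟨r, (h1.trans (p'.prec m1 r hr1)).add (h2.trans (q'.prec m2 r hr2))⟩

theorem PathEquiv.add {S T : Type*} [AddCommMonoid S] [PartialOrder S] [AddCommMonoid T]
    [PartialOrder T] [CuSemigroup S] [CuSemigroup T] {p p' q q' : CuPath S T}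
    (hp : PathEquiv p p') (hq : PathEquiv q q') : PathEquiv (p.add q) (p'.add q') :=
  ⟨PathLE.add hp.1 hq.1, PathLE.add hp.2 hq.2⟩

namespace BivCu

variable {S T P : Type*} [AddCommMonoid S] [PartialOrder S] [AddCommMonoid T] [PartialOrder T]
  [AddCommMonoid P] [PartialOrder P]

instance [CuSemigroup S] [CuSemigroup T] : Add (BivCu S T) where
  add := Quotient.map₂ CuPath.add (fun _ _ hp _ _ hq => PathEquiv.add hp hq)

instance [CuSemigroup S] [CuSemigroup T] : Zero (BivCu S T) where
  zero := mk (CuPath.zero S T)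

instance [CuSemigroup S] [CuSemigroup T] : AddCommMonoid (BivCu S T) where
  add := (· + ·)
  zero := 0
  add_assoc := by
    rintro ⟨p⟩ ⟨q⟩ ⟨r⟩
    exact congrArg (Quotient.mk _) (CuPath.ext' (funext fun l => add_assoc _ _ _))
  zero_add := by
    rintro ⟨p⟩
    exact congrArg (Quotient.mk _) (CuPath.ext' (funext fun l => zero_add _))
  add_zero := by
    rintro ⟨p⟩
    exact congrArg (Quotient.mk _) (CuPath.ext' (funext fun l => add_zero _))
  add_comm := by
    rintro ⟨p⟩ ⟨q⟩
    exact congrArg (Quotient.mk _) (CuPath.ext' (funext fun l => add_comm _ _))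
  nsmul := nsmulRec
  nsmul_zero := fun _ => rfl
  nsmul_succ := fun _ _ => rfl

theorem mk_add_mk [CuSemigroup S] [CuSemigroup T] (p q : CuPath S T) :
    mk p + mk q = mk (p.add q) := rfl

end BivCu

/-- Composition of paths. -/
def CuPath.comp {S T P : Type*} [AddCommMonoid S] [PartialOrder S] [AddCommMonoid T]
    [PartialOrder T] [AddCommMonoid P] [PartialOrder P]
    (q : CuPath T P) (p : CuPath S T) : CuPath S P where
  f l := (q.f l).comp (p.f l)
  prec l m h := Prec.comp (p.prec l m h) (q.prec l m h)

theorem PathLE.comp {S T P : Type*} [AddCommMonoid S] [PartialOrder S] [AddCommMonoid T]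
    [PartialOrder T] [AddCommMonoid P] [PartialOrder P] [CuSemigroup S] [CuSemigroup T]
    {q q' : CuPath T P} {p p' : CuPath S T} (hq : PathLE q q') (hp : PathLE p p') :
    PathLE (q.comp p) (q'.comp p') := by
  intro l
  obtain ⟨m1, h1⟩ := hp l
  obtain ⟨m2, h2⟩ := hq l
  obtain ⟨r, hr1, hr2⟩ := IQ.exists_gt₂ m1 m2
  exact ⟨r, Prec.comp (h1.trans (p'.prec m1 r hr1)) (h2.trans (q'.prec m2 r hr2))⟩

theorem PathEquiv.comp {S T P : Type*} [AddCommMonoid S] [PartialOrder S] [AddCommMonoid T]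
    [PartialOrder T] [AddCommMonoid P] [PartialOrder P] [CuSemigroup S] [CuSemigroup T]
    {q q' : CuPath T P} {p p' : CuPath S T} (hq : PathEquiv q q') (hp : PathEquiv p p') :
    PathEquiv (q.comp p) (q'.comp p') :=
  ⟨PathLE.comp hq.1 hp.1, PathLE.comp hq.2 hp.2⟩

/-- The composition product on bivariant Cu-semigroups. -/
def BivCu.comp {S T P : Type*} [AddCommMonoid S] [PartialOrder S] [AddCommMonoid T]
    [PartialOrder T] [AddCommMonoid P] [PartialOrder P] [CuSemigroup S] [CuSemigroup T]
    (y : BivCu T P) (x : BivCu S T) : BivCu S P :=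
  Quotient.map₂ CuPath.comp (fun _ _ hq _ _ hp => PathEquiv.comp hq hp) y x

theorem BivCu.comp_mk_mk {S T P : Type*} [AddCommMonoid S] [PartialOrder S] [AddCommMonoid T]
    [PartialOrder T] [AddCommMonoid P] [PartialOrder P] [CuSemigroup S] [CuSemigroup T]
    (q : CuPath T P) (p : CuPath S T) :
    BivCu.comp (BivCu.mk q) (BivCu.mk p) = BivCu.mk (q.comp p) := rfl

/-- The constant path at the identity morphism. -/
def CuPath.id (S : Type*) [AddCommMonoid S] [PartialOrder S] : CuPath S S where
  f _ := GenCuMor.id S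
  prec _ _ _ := fun _ _ ha => ha

/-- The class of the constant path at the identity: the unit of `⟦S,S⟧`. -/
def BivCu.id (S : Type*) [AddCommMonoid S] [PartialOrder S] [CuSemigroup S] : BivCu S S :=
  BivCu.mk (CuPath.id S)

/-! ### Ideals, morphism predicates, bimorphisms, softness, elementary paths -/

/-- An ideal of a Cu-semigroup: a downward hereditary submonoid closed under
suprema of increasing sequences. -/
def IsCuIdeal {S : Type*} [AddCommMonoid S] [PartialOrder S] (J : Set S) : Prop :=
  (0 : S) ∈ J ∧ (∀ a b : S, a ∈ J → b ∈ J → a + b ∈ J) ∧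
  (∀ a b : S, b ≤ a → a ∈ J → b ∈ J) ∧
  (∀ c : ℕ → S, Monotone c → (∀ n, c n ∈ J) → ∀ s : S, IsLUB (Set.range c) s → s ∈ J)

/-- Predicate: `f` is (the function of) a generalized Cu-morphism. -/
def IsGenCuMorFun {S T : Type*} [AddCommMonoid S] [PartialOrder S] [AddCommMonoid T]
    [PartialOrder T] (f : S → T) : Prop :=
  f 0 = 0 ∧ (∀ a b : S, f (a + b) = f a + f b) ∧ Monotone f ∧
  ∀ (c : ℕ → S) (s : S), Monotone c → IsLUB (Set.range c) s →
    IsLUB (Set.range (fun n => f (c n))) (f s)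

/-- Predicate: `f` is a Cu-morphism (generalized Cu-morphism preserving way-below). -/
def IsCuMorFun {S T : Type*} [AddCommMonoid S] [PartialOrder S] [AddCommMonoid T]
    [PartialOrder T] (f : S → T) : Prop :=
  IsGenCuMorFun f ∧ ∀ a b : S, WayBelow a b → WayBelow (f a) (f b)

/-- Predicate: `φ` is a Cu-bimorphism. -/
def IsCuBimor {A B C : Type*} [AddCommMonoid A] [PartialOrder A] [AddCommMonoid B]
    [PartialOrder B] [AddCommMonoid C] [PartialOrder C] (φ : A → B → C) : Prop :=
  (∀ b : B, φ 0 b = 0) ∧ (∀ a : A, φ a 0 = 0) ∧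
  (∀ (a a' : A) (b : B), φ (a + a') b = φ a b + φ a' b) ∧
  (∀ (a : A) (b b' : B), φ a (b + b') = φ a b + φ a b') ∧
  (∀ (a a' : A) (b : B), a ≤ a' → φ a b ≤ φ a' b) ∧
  (∀ (a : A) (b b' : B), b ≤ b' → φ a b ≤ φ a b') ∧
  (∀ (c : ℕ → A) (d : ℕ → B) (s : A) (t : B), Monotone c → Monotone d →
    IsLUB (Set.range c) s → IsLUB (Set.range d) t →
    IsLUB (Set.range (fun n => φ (c n) (d n))) (φ s t)) ∧
  (∀ (a' a : A) (b' b : B), WayBelow a' a → WayBelow b' b → WayBelow (φ a' b') (φ a b))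

/-- A path in `(R, ≪)`: a `ℚ ∩ (0,1)`-indexed family, increasing with respect to
the way-below relation. -/
structure ElemPath (R : Type*) [Preorder R] where
  f : IQ → R
  prec : ∀ l m : IQ, l.1 < m.1 → WayBelow (f l) (f m)

/-- A soft element of a Cu-semigroup. -/
def IsSoft {S : Type*} [AddCommMonoid S] [PartialOrder S] (a : S) : Prop :=
  ∀ a' : S, WayBelow a' a → ∃ k : ℕ, (k + 1) • a' ≤ k • a

/-! ### Cu-semirings: the left regular representation -/

/-- `IsAddOrderIso f` : `f` is a bijective additive order-isomorphism. -/
def IsAddOrderIso {A B : Type*} [AddCommMonoid A] [PartialOrder A] [AddCommMonoid B]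
    [PartialOrder B] (f : A → B) : Prop :=
  Function.Bijective f ∧ f 0 = 0 ∧ (∀ a b : A, f (a + b) = f a + f b) ∧
  (∀ a b : A, a ≤ b ↔ f a ≤ f b)

/-- The graph of the left regular representation `π_R : R → ⟦R,R⟧` of a Cu-semiring
`(R, mul)` : `IsPiR mul r x` holds iff `x` is the class of the path of left
multiplications by a path in `(R,≪)` with endpoint `r`. -/
def IsPiR {R : Type*} [AddCommMonoid R] [PartialOrder R] [CuSemigroup R]
    (mul : R → R → R) (r : R) (x : BivCu R R) : Prop :=
  ∃ (g : ElemPath R) (P : CuPath R R),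
    IsLUB (Set.range g.f) r ∧ (∀ (l : IQ) (a : R), (P.f l).toFun a = mul (g.f l) a) ∧
    x = BivCu.mk P

namespace IQ

/-- The order isomorphism `x ↦ x / (1 - x)` from `ℚ ∩ (0,1)` onto the positive rationals. -/
def toPos (l : IQ) : ℚ := l.1 / (1 - l.1)

/-- The inverse `x ↦ x / (1 + x)` of `IQ.toPos`. -/
def ofPos (x : ℚ) (hx : 0 < x) : IQ :=
  ⟨x / (1 + x), by positivity, by rw [div_lt_one (by positivity)]; linarith⟩

theorem toPos_ofPos (x : ℚ) (hx : 0 < x) : toPos (ofPos x hx) = x := by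
  have : 1 + x ≠ 0 := by positivity
  simp only [toPos, ofPos]
  field_simp
  ring

theorem toPos_pos (l : IQ) : 0 < toPos l :=
  div_pos l.2.1 (by linarith [l.2.2])

theorem toPos_lt_toPos {l m : IQ} : toPos l < toPos m ↔ l.1 < m.1 := by
  have h1 : 0 < 1 - l.1 := by linarith [l.2.2]
  have h2 : 0 < 1 - m.1 := by linarith [m.2.2]
  unfold toPos
  rw [div_lt_div_iff₀ h1 h2]
  constructor <;> intro h <;> nlinarith

/-- The cofinal sequence `(n + 1) / (n + 2)` in `ℚ ∩ (0,1)`. -/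
def seq (n : ℕ) : IQ := ofPos (n + 1) (by positivity)

theorem toPos_seq (n : ℕ) : toPos (seq n) = n + 1 := toPos_ofPos _ _

instance : Nonempty IQ := ⟨seq 0⟩

theorem seq_strictMono : StrictMono seq := fun m n h => by
  change (seq m).1 < (seq n).1
  rw [← toPos_lt_toPos, toPos_seq, toPos_seq]
  exact_mod_cast Nat.succ_lt_succ h

theorem exists_lt_seq (l : IQ) (k : ℕ) : ∃ n, k ≤ n ∧ l.1 < (seq n).1 := by
  obtain ⟨n, hn⟩ := exists_nat_gt (toPos l)
  refine ⟨max k n, le_max_left _ _, ?_⟩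
  rw [← toPos_lt_toPos, toPos_seq]
  have : (n : ℚ) ≤ (max k n : ℕ) := by exact_mod_cast le_max_right k n
  linarith

end IQ

theorem isLUB_range_seq_iff {R : Type*} [Preorder R] {f : IQ → R} (hf : Monotone f) {r : R} :
    IsLUB (Set.range fun n => f (IQ.seq n)) r ↔ IsLUB (Set.range f) r := by
  have h : upperBounds (Set.range fun n => f (IQ.seq n)) = upperBounds (Set.range f) := by
    apply Set.Subset.antisymm
    · rintro x hx _ ⟨l, rfl⟩
      obtain ⟨n, -, hn⟩ := IQ.exists_lt_seq l 0
      exact (hf (show l ≤ IQ.seq n from hn.le)).trans (hx (Set.mem_range_self n))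
    · rintro x hx _ ⟨n, rfl⟩
      exact hx (Set.mem_range_self _)
  unfold IsLUB
  rw [h]

namespace ElemPath

theorem monotone {R : Type*} [Preorder R] (g : ElemPath R) : Monotone g.f := fun l m h => by
  rcases eq_or_lt_of_le h with rfl | h
  · exact le_rfl
  · exact (g.prec l m h).le

theorem isLUB_seq {R : Type*} [Preorder R] (g : ElemPath R) {r : R}
    (hg : IsLUB (Set.range g.f) r) : IsLUB (Set.range fun n => g.f (IQ.seq n)) r :=
  (isLUB_range_seq_iff g.monotone).2 hg

theorem exists_le_of_wayBelow {R : Type*} [Preorder R] (g : ElemPath R) {a r : R}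
    (hg : IsLUB (Set.range g.f) r) (h : WayBelow a r) : ∃ l, a ≤ g.f l := by
  obtain ⟨n, hn⟩ := h _ (g.monotone.comp IQ.seq_strictMono.monotone) r (g.isLUB_seq hg) le_rfl
  exact ⟨_, hn⟩

theorem wayBelow {R : Type*} [Preorder R] (g : ElemPath R) {r : R}
    (hg : IsLUB (Set.range g.f) r) (l : IQ) : WayBelow (g.f l) r := by
  obtain ⟨m, hm⟩ := IQ.exists_gt l
  exact WayBelow.of_le_right (g.prec l m hm) (hg.1 (Set.mem_range_self m))

end ElemPath

/-- Iterated dyadic refinement of a sequence: `dyadicRefine mid c n k` is the value at `k / 2 ^ n`,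
where `mid` fills in the midpoints. -/
def dyadicRefine {R : Type*} (mid : R → R → R) (c : ℕ → R) : ℕ → ℕ → R
  | 0, k => c k
  | n + 1, k =>
    if k % 2 = 0 then dyadicRefine mid c n (k / 2)
    else mid (dyadicRefine mid c n (k / 2)) (dyadicRefine mid c n (k / 2 + 1))

section DyadicRefine

variable {R : Type*} {mid : R → R → R} {c : ℕ → R}

theorem dyadicRefine_succ_two_mul (n k : ℕ) :
    dyadicRefine mid c (n + 1) (2 * k) = dyadicRefine mid c n k := by
  simp [dyadicRefine]

theorem dyadicRefine_succ_two_mul_add_one (n k : ℕ) :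
    dyadicRefine mid c (n + 1) (2 * k + 1) =
      mid (dyadicRefine mid c n k) (dyadicRefine mid c n (k + 1)) := by
  have h1 : (2 * k + 1) % 2 = 1 := by omega
  have h2 : (2 * k + 1) / 2 = k := by omega
  simp [dyadicRefine, h1, h2]

theorem dyadicRefine_add_two_pow_mul (n m k : ℕ) :
    dyadicRefine mid c (n + m) (2 ^ m * k) = dyadicRefine mid c n k := by
  induction m with
  | zero => simp
  | succ m ih =>
    rw [← ih, ← dyadicRefine_succ_two_mul (n + m), pow_succ, ← add_assoc]
    congr 1
    ring

theorem dyadicRefine_wayBelow_succ [Preorder R]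
    (hmid : ∀ a b, WayBelow a b → WayBelow a (mid a b) ∧ WayBelow (mid a b) b)
    (hc : ∀ n, WayBelow (c n) (c (n + 1))) (n k : ℕ) :
    WayBelow (dyadicRefine mid c n k) (dyadicRefine mid c n (k + 1)) := by
  induction n generalizing k with
  | zero => exact hc k
  | succ n ih =>
    obtain ⟨j, rfl | rfl⟩ := Nat.even_or_odd' k
    · rw [dyadicRefine_succ_two_mul, dyadicRefine_succ_two_mul_add_one]
      exact (hmid _ _ (ih j)).1
    · rw [show 2 * j + 1 + 1 = 2 * (j + 1) by ring, dyadicRefine_succ_two_mul,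
        dyadicRefine_succ_two_mul_add_one]
      exact (hmid _ _ (ih j)).2

theorem dyadicRefine_le [Preorder R]
    (hD : ∀ n, Monotone (dyadicRefine mid c n)) (n k : ℕ) :
    dyadicRefine mid c n k ≤ c k := by
  have h := dyadicRefine_add_two_pow_mul (mid := mid) (c := c) 0 n k
  rw [zero_add] at h
  change _ ≤ dyadicRefine mid c 0 k
  rw [← h]
  exact hD n (Nat.le_mul_of_pos_left k (by positivity))

end DyadicRefine

/-- Every element of a Cu-semigroup is the endpoint of a path in `(R, ≪)`. -/
theorem ElemPath.exists_isLUB {R : Type*} [AddCommMonoid R] [PartialOrder R] [CuSemigroup R]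
    (r : R) : ∃ g : ElemPath R, IsLUB (Set.range g.f) r := by
  classical
  obtain ⟨c, hc, hlub⟩ := CuSemigroup.O2 r
  have hex : ∀ a b : R, ∃ x, WayBelow a b → WayBelow a x ∧ WayBelow x b := fun a b => by
    by_cases h : WayBelow a b
    · exact (exists_interpolate h).imp fun _ hx _ => hx
    · exact ⟨a, fun h' => absurd h' h⟩
  choose mid hmid using hex
  set D := dyadicRefine mid c with hDdef
  have hstep : ∀ n k, WayBelow (D n k) (D n (k + 1)) := dyadicRefine_wayBelow_succ hmid hc
  have hD : ∀ n, Monotone (D n) := fun n => monotone_nat_of_le_succ fun k => (hstep n k).le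
  let E : IQ → ℕ → R := fun l n => D n ⌊2 ^ n * l.toPos⌋₊
  have hE : ∀ l, Monotone (E l) := fun l => monotone_nat_of_le_succ fun n => by
    change D n _ ≤ D (n + 1) _
    rw [hDdef, ← dyadicRefine_succ_two_mul, ← hDdef]
    refine hD _ (Nat.le_floor ?_)
    have := Nat.floor_le (show 0 ≤ 2 ^ n * l.toPos by have := l.toPos_pos; positivity)
    push_cast
    rw [pow_succ]
    linarith
  choose f hf using fun l => CuSemigroup.O1 (E l) (hE l)
  have hprec : ∀ l m : IQ, l.1 < m.1 → WayBelow (f l) (f m) := by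
    intro l m hlm
    have hl := l.toPos_pos
    have hlm' := IQ.toPos_lt_toPos.2 hlm
    obtain ⟨N, hN⟩ := pow_unbounded_of_one_lt (2 / (m.toPos - l.toPos)) (one_lt_two (α := ℚ))
    rw [div_lt_iff₀ (by linarith)] at hN
    set k := ⌊2 ^ N * l.toPos⌋₊ with hk
    have hkle : (k : ℚ) ≤ 2 ^ N * l.toPos := Nat.floor_le (by positivity)
    have hklt : 2 ^ N * l.toPos < k + 1 := Nat.lt_floor_add_one _
    refine WayBelow.of_le_left ?_ (WayBelow.of_le_right (hstep N (k + 1)) ?_)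
    · refine (hf l).2 ?_
      rintro _ ⟨n, rfl⟩
      refine (hE l (Nat.le_add_left n N)).trans ?_
      rw [hDdef, ← dyadicRefine_add_two_pow_mul N n, ← hDdef]
      refine hD _ (Nat.floor_le_of_le ?_)
      push_cast
      rw [pow_add, mul_right_comm, mul_comm]
      gcongr
    · refine le_trans (hD N (Nat.le_floor ?_)) ((hf m).1 (Set.mem_range_self N))
      push_cast
      linarith
  refine ⟨⟨f, hprec⟩, ?_, ?_⟩
  · rintro _ ⟨l, rfl⟩
    refine (hf l).2 ?_
    rintro _ ⟨n, rfl⟩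
    exact (dyadicRefine_le hD n _).trans (hlub.1 (Set.mem_range_self _))
  · intro x hx
    refine hlub.2 ?_
    rintro _ ⟨n, rfl⟩
    refine le_trans ?_ (hx (Set.mem_range_self (IQ.seq n)))
    refine le_trans ?_ ((hf (IQ.seq n)).1 (Set.mem_range_self 0))
    change D 0 n ≤ D 0 _
    refine hD 0 (Nat.le_floor ?_)
    rw [IQ.toPos_seq]
    simp

theorem Prec.of_le_left {S T : Type*} [AddCommMonoid S] [PartialOrder S] [AddCommMonoid T]
    [PartialOrder T] {f f' g : GenCuMor S T} (h : f ≤ f') (hg : Prec f' g) : Prec f g :=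
  fun a' a ha => WayBelow.of_le_left (h a') (hg a' a ha)

section Suprema

variable {S T : Type*} [AddCommMonoid S] [PartialOrder S] [AddCommMonoid T] [PartialOrder T]
  [CuSemigroup S]

theorem CuPath.exists_forall_le_prec (P : ℕ → CuPath S T) (hP : ∀ n, PathLE (P n) (P (n + 1)))
    (n : ℕ) (l : IQ) : ∃ m, ∀ k ≤ n, Prec ((P k).f l) ((P n).f m) := by
  induction n with
  | zero =>
    obtain ⟨m, hm⟩ := IQ.exists_gt l
    refine ⟨m, fun k hk => ?_⟩
    obtain rfl := Nat.le_zero.1 hk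
    exact (P 0).prec l m hm
  | succ n ih =>
    obtain ⟨m, hm⟩ := ih
    obtain ⟨m', hm'⟩ := hP n m
    obtain ⟨q, hq, hq'⟩ := IQ.exists_gt₂ m' l
    refine ⟨q, fun k hk => ?_⟩
    rcases Nat.le_succ_iff.1 hk with hk | rfl
    · exact ((hm k hk).trans hm').trans ((P (n + 1)).prec _ _ hq)
    · exact (P (n + 1)).prec _ _ hq'

/-- Concatenation of segments, indexed by `[a n, b n]`, of a sequence of paths. -/
theorem CuPath.exists_concat (P : ℕ → CuPath S T) (a b : ℕ → IQ) (hab : ∀ n, (a n).1 < (b n).1)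
    (hba : ∀ n, Prec ((P n).f (b n)) ((P (n + 1)).f (a (n + 1)))) :
    ∃ Q : CuPath S T, (∀ n, Q.f (IQ.seq n) = (P (n + 1)).f (a (n + 1))) ∧
      ∀ l, ∃ n m, Q.f l = (P n).f m := by
  let w : ℕ → ℚ → ℚ := fun n x => (a n).1 + (x - n) * ((b n).1 - (a n).1)
  have hd : ∀ n, 0 < (b n).1 - (a n).1 := fun n => sub_pos.2 (hab n)
  have hfl : ∀ l : IQ, (⌊l.toPos⌋₊ : ℚ) ≤ l.toPos := fun l => Nat.floor_le l.toPos_pos.le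
  have hlt : ∀ l : IQ, l.toPos < ⌊l.toPos⌋₊ + 1 := fun l => Nat.lt_floor_add_one _
  have hwa : ∀ l : IQ, (a ⌊l.toPos⌋₊).1 ≤ w ⌊l.toPos⌋₊ l.toPos := fun l => by
    have := mul_nonneg (sub_nonneg.2 (hfl l)) (hd ⌊l.toPos⌋₊).le
    simp only [w]
    linarith
  have hwb : ∀ l : IQ, w ⌊l.toPos⌋₊ l.toPos < (b ⌊l.toPos⌋₊).1 := fun l => by
    have := mul_pos (sub_pos.2 (hlt l)) (hd ⌊l.toPos⌋₊)
    simp only [w]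
    linarith
  let W : IQ → IQ := fun l => ⟨w ⌊l.toPos⌋₊ l.toPos,
    (a _).2.1.trans_le (hwa l), (hwb l).trans (b _).2.2⟩
  have hchain : ∀ n k, Prec ((P n).f (b n)) ((P (n + k + 1)).f (a (n + k + 1))) := by
    intro n k
    induction k with
    | zero => exact hba n
    | succ k ih => exact (ih.trans ((P _).prec _ _ (hab _))).trans (hba _)
  refine ⟨⟨fun l => (P ⌊l.toPos⌋₊).f (W l), ?_⟩, fun n => ?_, fun l => ⟨_, _, rfl⟩⟩
  · intro l m hlm
    have hlm' := IQ.toPos_lt_toPos.2 hlm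
    rcases eq_or_lt_of_le (Nat.floor_mono hlm'.le) with h | h
    · have hW : (W l).1 < (W m).1 := by
        have := mul_pos (sub_pos.2 hlm') (hd ⌊m.toPos⌋₊)
        simp only [W, w, h]
        linarith
      have := (P ⌊m.toPos⌋₊).prec (W l) (W m) hW
      simpa only [h] using this
    · have h1 := (P ⌊l.toPos⌋₊).prec (W l) _ (hwb l)
      obtain ⟨k, hk⟩ := Nat.exists_eq_add_of_lt h
      have h2 := h1.trans (hchain _ k)
      rw [← hk] at h2
      rcases eq_or_lt_of_le (hwa m) with h3 | h3
      · rwa [show a ⌊m.toPos⌋₊ = W m from Subtype.ext h3] at h2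
      · exact h2.trans ((P ⌊m.toPos⌋₊).prec _ (W m) h3)
  · have h : ⌊(IQ.seq n).toPos⌋₊ = n + 1 := by
      rw [IQ.toPos_seq]
      exact_mod_cast Nat.floor_natCast (R := ℚ) (n + 1)
    have hW : W (IQ.seq n) = a (n + 1) := by
      apply Subtype.ext
      simp only [W, w, h]
      rw [IQ.toPos_seq]
      push_cast
      ring
    simp only [h, hW]

/-- An increasing sequence of paths has an upper bound which is approximated by the sequence. -/
theorem CuPath.exists_upperBound (P : ℕ → CuPath S T) (hP : ∀ n, PathLE (P n) (P (n + 1))) :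
    ∃ Q : CuPath S T, (∀ n, PathLE (P n) Q) ∧ ∀ l, ∃ n m, Q.f l = (P n).f m := by
  choose G hG using CuPath.exists_forall_le_prec P hP
  choose B hB hB' using IQ.exists_gt₂
  let a : ℕ → IQ := fun n => Nat.rec (IQ.seq 0) (fun n x => G (n + 1) (B x (IQ.seq n))) n
  let b : ℕ → IQ := fun n => B (a n) (IQ.seq n)
  have hba : ∀ n, ∀ k ≤ n + 1, Prec ((P k).f (b n)) ((P (n + 1)).f (a (n + 1))) :=
    fun n => hG (n + 1) (b n)
  obtain ⟨Q, hQ, hQ'⟩ := CuPath.exists_concat P a b (fun n => hB _ _)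
    (fun n => hba n n n.le_succ)
  refine ⟨Q, fun k l => ?_, hQ'⟩
  obtain ⟨n, hkn, hn⟩ := IQ.exists_lt_seq l k
  refine ⟨IQ.seq n, ?_⟩
  rw [hQ]
  exact ((P k).prec _ _ (hn.trans (hB' _ _))).trans (hba n k (hkn.trans n.le_succ))

theorem BivCu.mk_surjective : Function.Surjective (BivCu.mk : CuPath S T → BivCu S T) :=
  Quotient.mk_surjective

/-- Members of a path below the supremum of an increasing sequence are below some term. -/
theorem BivCu.exists_prec_of_le_isLUB {P : ℕ → CuPath S T} (hP : Monotone fun n => mk (P n))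
    {x : BivCu S T} (hx : IsLUB (Set.range fun n => mk (P n)) x) {p : CuPath S T} (hp : mk p ≤ x)
    (l : IQ) : ∃ n m, Prec (p.f l) ((P n).f m) := by
  obtain ⟨Q, hQ, hQ'⟩ := CuPath.exists_upperBound P fun n => mk_le_mk.1 (hP n.le_succ)
  have hxQ : x ≤ mk Q := hx.2 (by
    rintro _ ⟨n, rfl⟩
    exact mk_le_mk.2 (hQ n))
  obtain ⟨k, hk⟩ := mk_le_mk.1 (hp.trans hxQ) l
  obtain ⟨n, m, h⟩ := hQ' k
  exact ⟨n, m, h ▸ hk⟩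

end Suprema

namespace IsCuBimor

variable {R : Type*} [AddCommMonoid R] [PartialOrder R] {mul : R → R → R}

theorem mono_left (h : IsCuBimor mul) {a a' : R} (b : R) (ha : a ≤ a') : mul a b ≤ mul a' b :=
  h.2.2.2.2.1 a a' b ha

theorem wayBelow (h : IsCuBimor mul) {a' a b' b : R} (ha : WayBelow a' a) (hb : WayBelow b' b) :
    WayBelow (mul a' b') (mul a b) :=
  h.2.2.2.2.2.2.2 a' a b' b ha hb

/-- Left multiplication as a generalized Cu-morphism. -/
def leftMul (h : IsCuBimor mul) (r : R) : GenCuMor R R where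
  toFun := mul r
  map_zero' := h.2.1 r
  map_add' := h.2.2.2.1 r
  mono' := fun b b' => h.2.2.2.2.2.1 r b b'
  map_sup' := fun d t hd ht => h.2.2.2.2.2.2.1 (fun _ => r) d r t monotone_const hd
    (by rw [Set.range_const]; exact isLUB_singleton) ht

theorem leftMul_prec (h : IsCuBimor mul) {r s : R} (hrs : WayBelow r s) :
    Prec (h.leftMul r) (h.leftMul s) :=
  fun _ _ ha => h.wayBelow hrs ha

/-- The path of left multiplications along a path in `(R, ≪)`. -/
def leftMulPath (h : IsCuBimor mul) (g : ElemPath R) : CuPath R R where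
  f l := h.leftMul (g.f l)
  prec l m hlm := h.leftMul_prec (g.prec l m hlm)

/-- The product of two paths in `(R, ≪)`. -/
def mulPath (h : IsCuBimor mul) (g k : ElemPath R) : ElemPath R where
  f l := mul (g.f l) (k.f l)
  prec l m hlm := h.wayBelow (g.prec l m hlm) (k.prec l m hlm)

theorem isLUB_mulPath (h : IsCuBimor mul) {g k : ElemPath R} {r s : R}
    (hg : IsLUB (Set.range g.f) r) (hk : IsLUB (Set.range k.f) s) :
    IsLUB (Set.range (h.mulPath g k).f) (mul r s) :=
  (isLUB_range_seq_iff (h.mulPath g k).monotone).1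
    (h.2.2.2.2.2.2.1 _ _ r s (g.monotone.comp IQ.seq_strictMono.monotone)
      (k.monotone.comp IQ.seq_strictMono.monotone) (g.isLUB_seq hg) (k.isLUB_seq hk))

theorem leftMulPath_le (h : IsCuBimor mul) {g k : ElemPath R}
    (hgk : ∀ l, ∃ m, g.f l ≤ k.f m) : PathLE (h.leftMulPath g) (h.leftMulPath k) := by
  intro l
  obtain ⟨m, hm⟩ := hgk l
  obtain ⟨m', hm'⟩ := IQ.exists_gt m
  exact ⟨m', h.leftMul_prec (WayBelow.of_le_left hm (k.prec m m' hm'))⟩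

end IsCuBimor

/-- The sum of two paths in `(R, ≪)`. -/
def ElemPath.add {R : Type*} [AddCommMonoid R] [PartialOrder R] [CuSemigroup R]
    (g k : ElemPath R) : ElemPath R where
  f l := g.f l + k.f l
  prec l m h := CuSemigroup.O3 _ _ _ _ (g.prec l m h) (k.prec l m h)

theorem ElemPath.isLUB_add {R : Type*} [AddCommMonoid R] [PartialOrder R] [CuSemigroup R]
    {g k : ElemPath R} {r s : R} (hg : IsLUB (Set.range g.f) r) (hk : IsLUB (Set.range k.f) s) :
    IsLUB (Set.range (g.add k).f) (r + s) :=
  (isLUB_range_seq_iff (g.add k).monotone).1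
    (CuSemigroup.O4 _ _ r s (g.monotone.comp IQ.seq_strictMono.monotone)
      (k.monotone.comp IQ.seq_strictMono.monotone) (g.isLUB_seq hg) (k.isLUB_seq hk))

namespace IsPiR

variable {R : Type*} [AddCommMonoid R] [PartialOrder R] [CuSemigroup R] {mul : R → R → R}

theorem iff_exists_leftMulPath (h : IsCuBimor mul) {r : R} {x : BivCu R R} :
    IsPiR mul r x ↔
      ∃ g : ElemPath R, IsLUB (Set.range g.f) r ∧ x = BivCu.mk (h.leftMulPath g) := by
  constructor
  · rintro ⟨g, P, hg, hP, rfl⟩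
    refine ⟨g, hg, congrArg BivCu.mk (CuPath.ext' (funext fun l => GenCuMor.ext' (funext ?_)))⟩
    exact hP l
  · rintro ⟨g, hg, rfl⟩
    exact ⟨g, h.leftMulPath g, hg, fun _ _ => rfl, rfl⟩

theorem mono (h : IsCuBimor mul) {r s : R} {x y : BivCu R R} (hx : IsPiR mul r x)
    (hy : IsPiR mul s y) (hrs : r ≤ s) : x ≤ y := by
  obtain ⟨g, hg, rfl⟩ := (iff_exists_leftMulPath h).1 hx
  obtain ⟨k, hk, rfl⟩ := (iff_exists_leftMulPath h).1 hy
  exact BivCu.mk_le_mk.2 (h.leftMulPath_le fun l =>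
    k.exists_le_of_wayBelow hk (WayBelow.of_le_right (g.wayBelow hg l) hrs))

theorem unique (h : IsCuBimor mul) {r : R} {x y : BivCu R R} (hx : IsPiR mul r x)
    (hy : IsPiR mul r y) : x = y :=
  le_antisymm (hx.mono h hy le_rfl) (hy.mono h hx le_rfl)

theorem zero (h : IsCuBimor mul) : IsPiR mul 0 0 := by
  refine ⟨⟨fun _ => 0, fun _ _ _ => wayBelow_zero⟩, CuPath.zero R R, ?_, fun l a => ?_, rfl⟩
  · rw [Set.range_const]
    exact isLUB_singleton
  · exact (h.1 a).symm

theorem add (h : IsCuBimor mul) {r s : R} {x y : BivCu R R} (hx : IsPiR mul r x)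
    (hy : IsPiR mul s y) : IsPiR mul (r + s) (x + y) := by
  obtain ⟨g, P, hg, hP, rfl⟩ := hx
  obtain ⟨k, Q, hk, hQ, rfl⟩ := hy
  refine ⟨g.add k, P.add Q, ElemPath.isLUB_add hg hk, fun l a => ?_, rfl⟩
  change (P.f l).toFun a + (Q.f l).toFun a = mul (g.f l + k.f l) a
  rw [hP, hQ, h.2.2.1]

theorem comp (h : IsCuBimor mul) (hassoc : ∀ a b c : R, mul (mul a b) c = mul a (mul b c))
    {r s : R} {x y : BivCu R R} (hx : IsPiR mul r x) (hy : IsPiR mul s y) :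
    IsPiR mul (mul r s) (BivCu.comp x y) := by
  obtain ⟨g, P, hg, hP, rfl⟩ := hx
  obtain ⟨k, Q, hk, hQ, rfl⟩ := hy
  refine ⟨h.mulPath g k, P.comp Q, h.isLUB_mulPath hg hk, fun l a => ?_, rfl⟩
  change (P.f l).toFun ((Q.f l).toFun a) = mul (mul (g.f l) (k.f l)) a
  rw [hP, hQ, hassoc]

theorem one {one : R} (hone : ∀ a : R, mul one a = a) (hc : WayBelow one one) :
    IsPiR mul one (BivCu.id R) := by
  refine ⟨⟨fun _ => one, fun _ _ _ => hc⟩, CuPath.id R, ?_, fun l a => (hone a).symm, rfl⟩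
  rw [Set.range_const]
  exact isLUB_singleton

theorem isLUB (h : IsCuBimor mul) {c : ℕ → R} {s : R} (hc : Monotone c)
    (hs : IsLUB (Set.range c) s) {x : ℕ → BivCu R R} {y : BivCu R R}
    (hx : ∀ n, IsPiR mul (c n) (x n)) (hy : IsPiR mul s y) : IsLUB (Set.range x) y := by
  constructor
  · rintro _ ⟨n, rfl⟩
    exact (hx n).mono h hy (hs.1 (Set.mem_range_self n))
  · intro z hz
    obtain ⟨g, hg, rfl⟩ := (iff_exists_leftMulPath h).1 hy
    obtain ⟨q, rfl⟩ := BivCu.mk_surjective z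
    refine BivCu.mk_le_mk.2 fun l => ?_
    obtain ⟨m, hm⟩ := IQ.exists_gt l
    obtain ⟨n, hn⟩ := g.wayBelow hg m c hc s hs le_rfl
    obtain ⟨k, hk, hxk⟩ := (iff_exists_leftMulPath h).1 (hx n)
    obtain ⟨i, hi⟩ := k.exists_le_of_wayBelow hk (WayBelow.of_le_right (g.prec l m hm) hn)
    have hle : BivCu.mk (h.leftMulPath k) ≤ BivCu.mk q := hxk ▸ hz (Set.mem_range_self n)
    obtain ⟨j, hj⟩ := BivCu.mk_le_mk.1 hle i
    have hle' : h.leftMul (g.f l) ≤ h.leftMul (k.f i) := fun a => h.mono_left a hi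
    exact ⟨j, Prec.of_le_left hle' hj⟩

theorem wayBelow (h : IsCuBimor mul) {r s : R} {x y : BivCu R R} (hx : IsPiR mul r x)
    (hy : IsPiR mul s y) (hrs : WayBelow r s) : WayBelow x y := by
  intro z hz t ht hyt
  choose P hP using fun n => BivCu.mk_surjective (z n)
  obtain rfl : (fun n => BivCu.mk (P n)) = z := funext hP
  obtain ⟨g, hg, rfl⟩ := (iff_exists_leftMulPath h).1 hx
  obtain ⟨k, hk, rfl⟩ := (iff_exists_leftMulPath h).1 hy
  obtain ⟨l, hl⟩ := k.exists_le_of_wayBelow hk hrs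
  obtain ⟨n, m, hnm⟩ := BivCu.exists_prec_of_le_isLUB hz ht hyt l
  refine ⟨n, BivCu.mk_le_mk.2 fun i => ⟨m, Prec.of_le_left (fun a => ?_) hnm⟩⟩
  exact h.mono_left a ((hg.1 (Set.mem_range_self i)).trans hl)

end IsPiR

/-- For a Cu-semiring `R`, the left multiplications along any path in
`(R,≪)` with endpoint `r` form a path in `Cu[R,R]`; its class `π_R(r) ∈ ⟦R,R⟧` is
independent of the chosen path; the resulting map `π_R : R → ⟦R,R⟧` is a Cu-morphism and
is multiplicative: `π_R(rs) = π_R(r) ∘ π_R(s)`. If the unit of `R` is compact, then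
`π_R(1) = ⟨id_R⟩`. -/
theorem leftRegularRepresentation
    (R : Type*) [AddCommMonoid R] [PartialOrder R] [CuSemigroup R]
    (mul : R → R → R) (one : R) (hbi : IsCuBimor mul)
    (hassoc : ∀ a b c : R, mul (mul a b) c = mul a (mul b c))
    (hone : ∀ a : R, mul a one = a) (hone' : ∀ a : R, mul one a = a) :
    (∀ (r : R) (g : ElemPath R), IsLUB (Set.range g.f) r →
      ∃ P : CuPath R R, ∀ (l : IQ) (a : R), (P.f l).toFun a = mul (g.f l) a) ∧
    (∀ r : R, ∃ x : BivCu R R, IsPiR mul r x) ∧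
    (∀ (r : R) (x y : BivCu R R), IsPiR mul r x → IsPiR mul r y → x = y) ∧
    (∀ piR : R → BivCu R R, (∀ r : R, IsPiR mul r (piR r)) → IsCuMorFun piR) ∧
    (∀ (r s : R) (x y z : BivCu R R), IsPiR mul r x → IsPiR mul s y →
      IsPiR mul (mul r s) z → z = BivCu.comp x y) ∧
    (WayBelow one one → ∀ x : BivCu R R, IsPiR mul one x → x = BivCu.id R) := by
  refine ⟨fun r g _ => ⟨hbi.leftMulPath g, fun _ _ => rfl⟩, fun r => ?_,
    fun r x y hx hy => hx.unique hbi hy, fun piR h => ⟨⟨?_, fun a b => ?_, fun a b hab => ?_,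
      fun c s hc hs => ?_⟩, fun a b hab => ?_⟩,
    fun r s x y z hx hy hz => hz.unique hbi (hx.comp hbi hassoc hy),
    fun hc x hx => hx.unique hbi (IsPiR.one hone' hc)⟩
  · obtain ⟨g, hg⟩ := ElemPath.exists_isLUB r
    exact ⟨_, (IsPiR.iff_exists_leftMulPath hbi).2 ⟨g, hg, rfl⟩⟩
  · exact (h 0).unique hbi (IsPiR.zero hbi)
  · exact (h (a + b)).unique hbi ((h a).add hbi (h b))
  · exact (h a).mono hbi (h b) hab
  · exact IsPiR.isLUB hbi hc hs (fun n => h (c n)) (h s)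
  · exact (h a).wayBelow hbi (h b) hab
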